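/- Let φ := ⋀_{1≤i≤n} cᵢ be a propositional formula in 3-CNF with clauses cᵢ = ℓᵢ₁ ∨ ℓᵢ₂ ∨ ℓᵢ₃ over the variables x₁,…,xₘ, let cᵢ' := cᵢ[¬x₁/x₁',…,¬xₘ/xₘ'] be obtained by replacing every negated variable by a corresponding fresh primed variable, and let Σ := {Lcᵢ' : 1 ≤ i ≤ n} ∪ {xⱼ ∨ Lxⱼ', Lxⱼ ∨ xⱼ' : 1 ≤ j ≤ m}. Then Σ has a stable expansion if and only if φ is satisfiable. -/

import Mathlib

/-- Autoepistemic formulas: propositional variables, Boolean connectives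
`⊤, ⊥, ¬, ∧, ∨, ⊕`, and the modal operator `L` (`box`). -/
inductive AE : Type
  | var : ℕ → AE
  | top : AE
  | bot : AE
  | neg : AE → AE
  | conj : AE → AE → AE
  | disj : AE → AE → AE
  | xor : AE → AE → AE
  | box : AE → AE
  deriving DecidableEq

namespace AE

/-- Propositional evaluation of an autoepistemic formula, where `v` assigns
truth values to propositional variables and `w` assigns truth values to
`L`-prefixed formulas (which are treated as atoms). -/
def eval (v : ℕ → Bool) (w : AE → Bool) : AE → Bool
  | var n => v n
  | top => true
  | bot => false
  | neg φ => !(eval v w φ)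
  | conj φ ψ => eval v w φ && eval v w ψ
  | disj φ ψ => eval v w φ || eval v w ψ
  | xor φ ψ => (eval v w φ) != (eval v w ψ)
  | box φ => w φ

/-- Propositional consequence, treating `L`-prefixed formulas as atoms. -/
def entails (S : Set AE) (φ : AE) : Prop :=
  ∀ v w, (∀ ψ ∈ S, eval v w ψ = true) → eval v w φ = true

/-- Deductive closure. -/
def Th (S : Set AE) : Set AE := {φ | entails S φ}

/-- `Δ` is a stable expansion of `S` if `Δ = Th (S ∪ L(Δ) ∪ ¬L(Δᶜ))`. -/
def IsStableExpansion (S Δ : Set AE) : Prop :=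
  Δ = Th (S ∪ (box '' Δ) ∪ ((fun φ => neg (box φ)) '' Δᶜ))

/-- The set of subformulas of a formula (including the formula itself). -/
def subf : AE → Set AE
  | var n => {var n}
  | top => {top}
  | bot => {bot}
  | neg φ => insert (neg φ) (subf φ)
  | conj φ ψ => insert (conj φ ψ) (subf φ ∪ subf ψ)
  | disj φ ψ => insert (disj φ ψ) (subf φ ∪ subf ψ)
  | xor φ ψ => insert (xor φ ψ) (subf φ ∪ subf ψ)
  | box φ => insert (box φ) (subf φ)

/-- `SF^L(S)`: the `L`-prefixed subformulas of formulas in `S`. -/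
def SFL (S : Set AE) : Set AE := {χ | (∃ φ ∈ S, χ ∈ subf φ) ∧ ∃ ψ, χ = box ψ}

/-- `¬SF^L(S)`. -/
def negSFL (S : Set AE) : Set AE := neg '' SFL S

/-- `Λ` is an `S`-full set. -/
def IsFull (S Λ : Set AE) : Prop :=
  Λ ⊆ SFL S ∪ negSFL S ∧
  ∀ φ, box φ ∈ SFL S →
    (entails (S ∪ Λ) φ ↔ box φ ∈ Λ) ∧ (¬ entails (S ∪ Λ) φ ↔ neg (box φ) ∈ Λ)


/-- Translation of a 3-CNF literal `(xⱼ, b)` into a formula, where a negative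
literal `¬xⱼ` is replaced by the fresh primed variable `xⱼ'`:
`u` names the variables `xⱼ`, `p` names the primed variables `xⱼ'`. -/
def cnfLitForm {m : ℕ} (u p : Fin m → ℕ) : Fin m × Bool → AE
  | (j, true) => var (u j)
  | (j, false) => var (p j)

/-- The clause `cᵢ' = ℓᵢ₁ ∨ ℓᵢ₂ ∨ ℓᵢ₃` with negated variables primed. -/
def clauseForm {m : ℕ} (u p : Fin m → ℕ) (c : Fin 3 → Fin m × Bool) : AE :=
  disj (cnfLitForm u p (c 0)) (disj (cnfLitForm u p (c 1)) (cnfLitForm u p (c 2)))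

/-- `Σ = {Lcᵢ' : i} ∪ {xⱼ ∨ Lxⱼ', Lxⱼ ∨ xⱼ' : j}` for a 3-CNF with clauses `C`. -/
def sigmaCNF {k m : ℕ} (u p : Fin m → ℕ) (C : Fin k → Fin 3 → Fin m × Bool) : Set AE :=
  {φ | ∃ i : Fin k, φ = box (clauseForm u p (C i))} ∪
  {φ | ∃ j : Fin m, φ = disj (var (u j)) (box (var (p j)))} ∪
  {φ | ∃ j : Fin m, φ = disj (box (var (u j))) (var (p j))}

/-- `σ` satisfies the 3-CNF with clauses `C`. -/
def satCNF {k m : ℕ} (C : Fin k → Fin 3 → Fin m × Bool) (σ : Fin m → Bool) : Prop :=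
  ∀ i : Fin k, ∃ l : Fin 3, σ (C i l).1 = (C i l).2

open Classical in
/-- The valuation of the `L`-atoms that makes exactly the members of `Δ` believed. -/
noncomputable def belief (Δ : Set AE) (φ : AE) : Bool := decide (φ ∈ Δ)

theorem belief_eq_true {Δ : Set AE} {φ : AE} : belief Δ φ = true ↔ φ ∈ Δ := by
  simp [belief]

theorem isStableExpansion_iff {S Δ : Set AE} :
    IsStableExpansion S Δ ↔ ∀ φ, φ ∈ Δ ↔
      ∀ v, (∀ ψ ∈ S, eval v (belief Δ) ψ = true) → eval v (belief Δ) φ = true := by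
  have models (v : ℕ → Bool) (w : AE → Bool) :
      (∀ ψ ∈ S ∪ (box '' Δ) ∪ ((fun φ => neg (box φ)) '' Δᶜ), eval v w ψ = true) ↔
        w = belief Δ ∧ ∀ ψ ∈ S, eval v w ψ = true := by
    constructor
    · intro h
      refine ⟨funext fun φ => ?_, fun ψ hψ => h ψ (Or.inl (Or.inl hψ))⟩
      by_cases hφ : φ ∈ Δ
      · have := h (box φ) (Or.inl (Or.inr ⟨φ, hφ, rfl⟩))
        simpa [belief, hφ, eval] using this
      · have := h (neg (box φ)) (Or.inr ⟨φ, hφ, rfl⟩)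
        simpa [belief, hφ, eval] using this
    · rintro ⟨rfl, h⟩ ψ ((hψ | ⟨φ, hφ, rfl⟩) | ⟨φ, hφ, rfl⟩)
      · exact h ψ hψ
      · simpa [eval, belief] using hφ
      · simpa [eval, belief] using hφ
  unfold IsStableExpansion Th entails
  simp only [models, Set.ext_iff, Set.mem_ofPred_eq]
  refine forall_congr' fun φ => iff_congr Iff.rfl ⟨fun h v hv => h v _ ⟨rfl, hv⟩, ?_⟩
  rintro h v w ⟨rfl, hv⟩
  exact h v hv

theorem models_sigmaCNF {k m : ℕ} {u p : Fin m → ℕ} {C : Fin k → Fin 3 → Fin m × Bool}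
    {v : ℕ → Bool} {w : AE → Bool} :
    (∀ ψ ∈ sigmaCNF u p C, eval v w ψ = true) ↔
      (∀ i, w (clauseForm u p (C i)) = true) ∧
      ∀ j, (v (u j) = true ∨ w (var (p j)) = true) ∧ (w (var (u j)) = true ∨ v (p j) = true) := by
  constructor
  · intro h
    refine ⟨fun i => h _ (Or.inl (Or.inl ⟨i, rfl⟩)), fun j => ⟨?_, ?_⟩⟩
    · simpa [eval] using h _ (Or.inl (Or.inr ⟨j, rfl⟩))
    · simpa [eval] using h _ (Or.inr ⟨j, rfl⟩)
  · rintro ⟨hc, hj⟩ ψ ((⟨i, rfl⟩ | ⟨j, rfl⟩) | ⟨j, rfl⟩)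
    · exact hc i
    · simpa [eval] using (hj j).1
    · simpa [eval] using (hj j).2

theorem eval_clauseForm {m : ℕ} {u p : Fin m → ℕ} {c : Fin 3 → Fin m × Bool}
    {v : ℕ → Bool} {w : AE → Bool} :
    eval v w (clauseForm u p c) = true ↔
      ∃ l, v (if (c l).2 then u (c l).1 else p (c l).1) = true := by
  have lit (x : Fin m × Bool) :
      eval v w (cnfLitForm u p x) = v (if x.2 then u x.1 else p x.1) := by
    rcases x with ⟨j, _ | _⟩ <;> rfl
  simp [clauseForm, eval, lit, Fin.exists_fin_succ]

open Classical in
/-- Evaluation of formulas in which `L` quantifies universally over a set `V` of valuations. -/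
noncomputable def possibleWorldsEval (V : Set (ℕ → Bool)) : AE → (ℕ → Bool) → Bool
  | var n, v => v n
  | top, _ => true
  | bot, _ => false
  | neg φ, v => !(possibleWorldsEval V φ v)
  | conj φ ψ, v => possibleWorldsEval V φ v && possibleWorldsEval V ψ v
  | disj φ ψ, v => possibleWorldsEval V φ v || possibleWorldsEval V ψ v
  | xor φ ψ, v => possibleWorldsEval V φ v != possibleWorldsEval V ψ v
  | box φ, _ => decide (∀ v ∈ V, possibleWorldsEval V φ v = true)

/-- Every set of valuations is the set of worlds of an introspective theory. -/
theorem exists_mem_iff_forall_eval (V : Set (ℕ → Bool)) :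
    ∃ Δ : Set AE, ∀ φ, φ ∈ Δ ↔ ∀ v ∈ V, eval v (belief Δ) φ = true := by
  let Δ : Set AE := {φ | ∀ v ∈ V, possibleWorldsEval V φ v = true}
  have key (φ : AE) (v : ℕ → Bool) : eval v (belief Δ) φ = possibleWorldsEval V φ v := by
    induction φ with
    | box φ => simp [eval, possibleWorldsEval, belief, Δ]
    | _ => simp_all [eval, possibleWorldsEval]
  exact ⟨Δ, fun φ => by simp [key, Δ]⟩

/-- `Σ` has a stable expansion iff the 3-CNF `φ = ⋀ᵢ cᵢ` is satisfiable. -/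
theorem sigmaCNF_has_expansion_iff_sat (k m : ℕ) (u p : Fin m → ℕ)
    (hinj : Function.Injective (Sum.elim u p : Fin m ⊕ Fin m → ℕ))
    (C : Fin k → Fin 3 → Fin m × Bool) :
    (∃ Δ : Set AE, IsStableExpansion (sigmaCNF u p C) Δ) ↔
    ∃ σ : Fin m → Bool, satCNF C σ := by
  have hne (i j : Fin m) : u i ≠ p j := fun h => by
    simpa using hinj (a₁ := Sum.inl i) (a₂ := Sum.inr j) h
  constructor
  · rintro ⟨Δ, hΔ⟩
    rw [isStableExpansion_iff] at hΔ
    simp only [models_sigmaCNF, belief_eq_true] at hΔ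
    have hclause (i : Fin k) : clauseForm u p (C i) ∈ Δ := by
      by_contra hi
      exact hi ((hΔ _).2 fun v hv => absurd (hv.1 i) hi)
    have hone (j : Fin m) : var (p j) ∈ Δ → var (u j) ∉ Δ := fun hp hu => by
      have := (hΔ _).1 hu (fun n => decide (n ≠ u j)) ⟨hclause, fun i => ?_⟩
      · simp [eval] at this
      · refine ⟨?_, Or.inr (by simpa using (hne j i).symm)⟩
        by_cases hij : i = j
        · exact Or.inr (hij ▸ hp)
        · refine Or.inl (decide_eq_true fun h => hij ?_)
          simpa using hinj (a₁ := Sum.inl i) (a₂ := Sum.inl j) h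
    have hsome (j : Fin m) : var (u j) ∈ Δ ∨ var (p j) ∈ Δ := by
      by_contra! h
      exact h.1 ((hΔ _).2 fun v hv => (hv.2 j).1.resolve_right h.2)
    refine ⟨fun j => belief Δ (var (u j)), fun i => ?_⟩
    have := (hΔ _).1 (hclause i) (fun n => belief Δ (var n))
      ⟨hclause, fun j => by simpa [belief_eq_true, or_comm] using hsome j⟩
    obtain ⟨l, hl⟩ := eval_clauseForm.1 this
    refine ⟨l, ?_⟩
    cases hb : (C i l).2
    · simp only [hb, belief_eq_true] at hl
      simpa [belief] using hone _ hl
    · simpa [hb] using hl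
  · rintro ⟨σ, hσ⟩
    obtain ⟨Δ, hΔ⟩ := exists_mem_iff_forall_eval
      {v | ∀ j, v (if σ j then u j else p j) = true}
    simp only [Set.mem_ofPred_eq] at hΔ
    have hclause (i : Fin k) : clauseForm u p (C i) ∈ Δ := by
      refine (hΔ _).2 fun v hv => eval_clauseForm.2 ?_
      obtain ⟨l, hl⟩ := hσ i
      exact ⟨l, hl ▸ hv _⟩
    have hu (j : Fin m) : var (u j) ∈ Δ ↔ σ j = true := by
      refine ⟨fun h => ?_, fun h => (hΔ _).2 fun v hv => by simpa [eval, h] using hv j⟩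
      by_contra hj
      have := (hΔ _).1 h (fun n => decide (n ≠ u j)) fun i => decide_eq_true ?_
      · simp [eval] at this
      · split_ifs with hi
        · rintro he
          have : i = j := by simpa using hinj (a₁ := Sum.inl i) (a₂ := Sum.inl j) he
          exact hj (this ▸ hi)
        · exact (hne j i).symm
    have hp (j : Fin m) : var (p j) ∈ Δ ↔ σ j = false := by
      refine ⟨fun h => ?_, fun h => (hΔ _).2 fun v hv => by simpa [eval, h] using hv j⟩
      by_contra hj
      have := (hΔ _).1 h (fun n => decide (n ≠ p j)) fun i => decide_eq_true ?_
      · simp [eval] at this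
      · split_ifs with hi
        · exact hne i j
        · rintro he
          have : i = j := by simpa using hinj (a₁ := Sum.inr i) (a₂ := Sum.inr j) he
          exact hj (by simpa [this] using hi)
    refine ⟨Δ, isStableExpansion_iff.2 fun φ => (hΔ φ).trans ?_⟩
    refine forall_congr' fun v => imp_congr_left ?_
    simp only [models_sigmaCNF, belief_eq_true, hclause, hu, hp, implies_true, true_and]
    refine forall_congr' fun j => ?_
    cases σ j <;> simp

end AE
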